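/- Let r ≥ 2 be even, p ≥ 1 with p | r/2, and n ≥ 0. Then in ℚ[u,v,w], f_{r,p,n}(u,v,w) = Σ_{j=⌈n/2⌉}^{n} (n−j)!·C(n; n−j, n−j, 2j−n)·u^{2j−n}·(v + (r−1)w^r)^{n−j}·(1 + w^{r/2})^{2j−n} / 2^{n−j}. -/

import Mathlib

open Finset MvPolynomial

/-- The colored permutation group `G_{r,n}`: pairs `(z, τ)` with `z : (ℤ/rℤ)ⁿ`
and `τ` a permutation of `[n]`. -/
abbrev ColoredPerm (r n : ℕ) : Type := (Fin n → ZMod r) × Equiv.Perm (Fin n)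

/-- Multiplication in `G_{r,n}`:
`(z, τ)(z', τ') = ((zᵢ + z'_{τ⁻¹(i)})ᵢ, τ ∘ τ')`. -/
def cpMul {r n : ℕ} (x y : ColoredPerm r n) : ColoredPerm r n :=
  (fun i => x.1 i + y.1 (x.2⁻¹ i), x.2 * y.2)

/-- The identity element of `G_{r,n}`. -/
def cpOne (r n : ℕ) : ColoredPerm r n := (fun _ => 0, 1)

/-- `π` is an involution: `π² = 1`. -/
def IsCPInvolution {r n : ℕ} (π : ColoredPerm r n) : Prop := cpMul π π = cpOne r n

instance {r n : ℕ} (π : ColoredPerm r n) : Decidable (IsCPInvolution π) :=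
  decidable_of_iff (cpMul π π = cpOne r n) Iff.rfl

/-- `csum π = Σᵢ zᵢ(π)`, each color regarded as an integer in `{0, …, r−1}`. -/
def csum {r n : ℕ} (π : ColoredPerm r n) : ℕ := ∑ i, (π.1 i).val

/-- `fix π`: the number of absolute fixed points, `#{i ∈ [n] : τ(i) = i}`. -/
noncomputable def fixc {r n : ℕ} (π : ColoredPerm r n) : ℕ := Nat.card {i : Fin n // π.2 i = i}

/-- `exc_A π = #{i ∈ {1, …, n−1} : z_{τ(i)}(π) = 0 and τ(i) > i}`
(`Fin n` encodes `[n]` via `i ↦ i + 1`, so `i ∈ {1, …, n−1}` reads `(i : ℕ) + 1 < n`). -/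
noncomputable def excA {r n : ℕ} (π : ColoredPerm r n) : ℕ :=
  Nat.card {i : Fin n // (i : ℕ) + 1 < n ∧ π.1 (π.2 i) = 0 ∧ i < π.2 i}

/-- The colored excedance number `exc^Clr π = r·exc_A π + csum π`. -/
noncomputable def excClr {r n : ℕ} (π : ColoredPerm r n) : ℕ := r * excA π + csum π

/-- `f_{r,p,n}(u,v,w) = Σ_{π ∈ I_{r,p,n}} u^{fix π} v^{exc_A π} w^{csum π}`,
regarded in `ℚ[u,v,w]`, where `I_{r,p,n}` is the set of involutions `π` of
`G_{r,n}` with `csum π ≡ 0 (mod p)`; the variables `u, v, w` are `X 0, X 1, X 2`. -/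
noncomputable def fpolyQ (r p n : ℕ) [NeZero r] : MvPolynomial (Fin 3) ℚ :=
  ∑ π : ColoredPerm r n,
    if IsCPInvolution π ∧ p ∣ csum π then
      X 0 ^ fixc π * X 1 ^ excA π * X 2 ^ csum π
    else 0

/-- The multinomial coefficient `C(n; a₁, …, a_k) = n!/(a₁!⋯a_k!)` when all
entries are nonnegative and sum to `n`, and `0` otherwise. -/
def multinomialZ (n : ℤ) (l : List ℤ) : ℕ :=
  if (∀ a ∈ l, 0 ≤ a) ∧ l.sum = n then
    n.toNat.factorial / (l.map fun a => a.toNat.factorial).prod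
  else 0

lemma isCPInvolution_iff {r n : ℕ} (z : Fin n → ZMod r) (τ : Equiv.Perm (Fin n)) :
    IsCPInvolution (z, τ) ↔ τ ^ 2 = 1 ∧ ∀ i, z i + z (τ i) = 0 := by
  simp only [IsCPInvolution, cpMul, cpOne, Prod.mk.injEq, funext_iff, ← pow_two]
  rw [and_comm]
  refine and_congr_right fun h => ?_
  have : τ⁻¹ = τ := inv_eq_of_mul_eq_one_left (by rw [← pow_two, h])
  rw [this]

lemma apply_apply_of_sq_eq_one {α : Type*} {τ : Equiv.Perm α} (h : τ ^ 2 = 1) (i : α) :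
    τ (τ i) = i := by
  rw [← Equiv.Perm.mul_apply, ← pow_two, h, Equiv.Perm.one_apply]

lemma prod_filter_gt_eq_prod_filter_lt {α M : Type*} [Fintype α] [LinearOrder α] [CommMonoid M]
    {τ : Equiv.Perm α} (h : τ ^ 2 = 1) (g : α → M) :
    ∏ i with τ i < i, g i = ∏ i with i < τ i, g (τ i) := by
  refine Finset.prod_nbij' τ τ ?_ ?_ ?_ ?_ ?_ <;>
    simp +contextual [apply_apply_of_sq_eq_one h]

lemma prod_eq_prod_fixed_mul_prod_lt {α M : Type*} [Fintype α] [LinearOrder α] [CommMonoid M]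
    {τ : Equiv.Perm α} (h : τ ^ 2 = 1) (g : α → M) :
    ∏ i, g i = (∏ i with τ i = i, g i) * ∏ i with i < τ i, (g i * g (τ i)) := by
  rw [Finset.prod_mul_distrib, ← prod_filter_gt_eq_prod_filter_lt h, Finset.prod_filter,
    Finset.prod_filter, Finset.prod_filter, ← Finset.prod_mul_distrib, ← Finset.prod_mul_distrib]
  refine Finset.prod_congr rfl fun i _ => ?_
  rcases lt_trichotomy i (τ i) with hi | hi | hi
  · simp [hi, hi.ne', hi.not_gt]
  · simp [← hi]
  · simp [hi, hi.ne, hi.not_gt]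

/-- The number of two-cycles of an involution. -/
def lowerCard {n : ℕ} (τ : Equiv.Perm (Fin n)) : ℕ := #{i | i < τ i}

lemma card_fixed_add_two_mul_lowerCard {n : ℕ} {τ : Equiv.Perm (Fin n)} (h : τ ^ 2 = 1) :
    #{i | τ i = i} + 2 * lowerCard τ = n := by
  have key := prod_eq_prod_fixed_mul_prod_lt h fun _ => 2
  simp only [Finset.prod_const, Finset.card_univ, Fintype.card_fin] at key
  rw [← pow_two, ← pow_mul, ← pow_add] at key
  exact (Nat.pow_right_injective le_rfl key).symm

lemma dvd_val_add_val {r : ℕ} [NeZero r] {a b : ZMod r} (h : a + b = 0) :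
    r ∣ a.val + b.val := by
  rw [← ZMod.natCast_eq_zero_iff]
  simpa using h

lemma val_add_val_of_add_eq_zero {r : ℕ} [NeZero r] {a b : ZMod r} (h : a + b = 0) :
    a.val + b.val = if a = 0 then 0 else r := by
  obtain rfl := eq_neg_of_add_eq_zero_right h
  rw [ZMod.neg_val]
  split_ifs with ha
  · simp [ha]
  · have := a.val_lt
    omega

lemma dvd_csum_of_isCPInvolution {r n p : ℕ} [NeZero r] (heven : Even r) (hpr : p ∣ r / 2)
    {π : ColoredPerm r n} (h : IsCPInvolution π) : p ∣ csum π := by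
  obtain ⟨-, hz⟩ := (isCPInvolution_iff π.1 π.2).1 h
  refine hpr.trans ?_
  have h2 : r ∣ 2 * csum π := by
    have : 2 * csum π = ∑ i, ((π.1 i).val + (π.1 (π.2 i)).val) := by
      rw [Finset.sum_add_distrib, Equiv.sum_comp π.2 fun i => (π.1 i).val, csum, two_mul]
    rw [this]
    exact Finset.dvd_sum fun i _ => dvd_val_add_val (hz i)
  obtain ⟨s, rfl⟩ := heven.two_dvd
  rw [Nat.mul_div_cancel_left _ two_pos]
  exact Nat.dvd_of_mul_dvd_mul_left two_pos h2

/-- The factor contributed by the color `a` at the position `i` to the weight of an involution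
with underlying permutation `τ`; a two-cycle is accounted for at its smaller element. -/
noncomputable def localWeight {r n : ℕ} (τ : Equiv.Perm (Fin n)) (i : Fin n) (a : ZMod r) :
    MvPolynomial (Fin 3) ℚ :=
  if τ i = i then X 0 * X 2 ^ a.val
  else if i < τ i then (if a = 0 then X 1 else X 2 ^ r) else 1

lemma weight_eq_prod_localWeight {r n : ℕ} [NeZero r] {z : Fin n → ZMod r}
    {τ : Equiv.Perm (Fin n)} (h : τ ^ 2 = 1) (hz : ∀ i, z i + z (τ i) = 0) :
    (X 0 ^ fixc (z, τ) * X 1 ^ excA (z, τ) * X 2 ^ csum (z, τ) : MvPolynomial (Fin 3) ℚ) =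
      ∏ i, localWeight τ i (z i) := by
  have hexc : excA (z, τ) = #{i ∈ {i | i < τ i} | z i = 0} := by
    rw [excA, Nat.card_eq_fintype_card, Fintype.card_subtype, Finset.filter_filter]
    congr 1
    ext i
    have h0 : z (τ i) = 0 ↔ z i = 0 := by
      have := hz i
      constructor <;> intro h' <;> simpa [h'] using this
    have hlt := (τ i).isLt
    simp only [h0, Finset.mem_filter, Finset.mem_univ, true_and, Fin.lt_def]
    constructor
    · tauto
    · rintro ⟨h1, h2⟩
      exact ⟨by omega, h2, h1⟩
  rw [hexc, fixc, Nat.card_eq_fintype_card, Fintype.card_subtype, csum,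
    ← Finset.prod_pow_eq_pow_sum, prod_eq_prod_fixed_mul_prod_lt h,
    prod_eq_prod_fixed_mul_prod_lt h (fun i => localWeight τ i (z i)),
    ← Finset.prod_const, ← Finset.prod_const, Finset.prod_filter (fun i => z i = 0),
    mul_mul_mul_comm, ← Finset.prod_mul_distrib, ← Finset.prod_mul_distrib]
  congr 1
  · refine Finset.prod_congr rfl fun i hi => ?_
    rw [localWeight, if_pos (Finset.mem_filter.1 hi).2]
  · refine Finset.prod_congr rfl fun i hi => ?_
    have hi := (Finset.mem_filter.1 hi).2
    rw [← pow_add, val_add_val_of_add_eq_zero (hz i)]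
    simp only [localWeight, apply_apply_of_sq_eq_one h, hi.ne, hi.ne', hi, hi.not_gt, if_true,
      if_false]
    split_ifs <;> simp

/-- The colors allowed at the position `i` of an involution with underlying permutation `τ`, where
the color of the larger element of a two-cycle is replaced by `0`. -/
def localColors (r : ℕ) [NeZero r] {n : ℕ} (τ : Equiv.Perm (Fin n)) (i : Fin n) :
    Finset (ZMod r) :=
  if τ i = i then univ.filter (fun a => a + a = 0) else if i < τ i then univ else {0}

lemma sum_prod_localWeight {r n : ℕ} [NeZero r] {τ : Equiv.Perm (Fin n)} (h : τ ^ 2 = 1) :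
    ∑ z : Fin n → ZMod r with ∀ i, z i + z (τ i) = 0, ∏ i, localWeight τ i (z i) =
      ∏ i, ∑ a ∈ localColors r τ i, localWeight τ i a := by
  rw [Finset.prod_univ_sum]
  refine Finset.sum_nbij' (fun z i => if τ i < i then 0 else z i)
    (fun y i => if τ i < i then - y (τ i) else y i) ?_ ?_ ?_ ?_ ?_
  · intro z hz
    simp only [Finset.mem_filter, Finset.mem_univ, true_and] at hz
    rw [Fintype.mem_piFinset]
    intro i
    have hzi := hz i
    rcases lt_trichotomy i (τ i) with hi | hi | hi
    · simp [localColors, hi, hi.ne']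
    · simpa [localColors, ← hi] using hzi
    · simp [localColors, hi, hi.ne, hi.not_gt]
  · intro y hy
    rw [Fintype.mem_piFinset] at hy
    simp only [Finset.mem_filter, Finset.mem_univ, true_and, apply_apply_of_sq_eq_one h]
    intro i
    have hyi := hy i
    rcases lt_trichotomy i (τ i) with hi | hi | hi
    · simp [hi, hi.not_gt]
    · simpa [localColors, ← hi] using hyi
    · simp [hi, hi.not_gt]
  · intro z hz
    simp only [Finset.mem_filter, Finset.mem_univ, true_and] at hz
    funext i
    have hzi := hz i
    simp only [apply_apply_of_sq_eq_one h]
    split_ifs with h1 h2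
    · exact absurd h1 h2.not_gt
    · exact (eq_neg_of_add_eq_zero_left hzi).symm
    · rfl
  · intro y hy
    rw [Fintype.mem_piFinset] at hy
    funext i
    have hyi := hy i
    dsimp only
    split_ifs with h1
    · simp only [localColors, h1.ne, h1.not_gt, if_false, Finset.mem_singleton] at hyi
      exact hyi.symm
    · rfl
  · intro z _
    refine Finset.prod_congr rfl fun i _ => ?_
    dsimp only
    split_ifs with h1
    · simp [localWeight, h1.ne, h1.not_gt]
    · rfl

lemma filter_add_self_eq_zero {s : ℕ} [NeZero (2 * s)] :
    ({a | a + a = 0} : Finset (ZMod (2 * s))) = {0, (s : ZMod (2 * s))} := by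
  ext a
  simp only [Finset.mem_filter, Finset.mem_univ, true_and, Finset.mem_insert,
    Finset.mem_singleton]
  constructor
  · intro ha
    obtain ⟨c, hc⟩ := dvd_val_add_val ha
    have hlt := a.val_lt
    have hcs : a.val = s * c := by linarith
    have hc2 : c < 2 := by
      by_contra! hc2
      nlinarith
    rw [← ZMod.natCast_zmod_val a, hcs]
    interval_cases c <;> simp
  · rintro (rfl | rfl)
    · simp
    · rw [← two_mul]
      exact_mod_cast ZMod.natCast_self (2 * s)

lemma sum_localWeight {r n : ℕ} [NeZero r] (heven : Even r) (τ : Equiv.Perm (Fin n)) (i : Fin n) :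
    ∑ a ∈ localColors r τ i, localWeight τ i a =
      if τ i = i then X 0 * (1 + X 2 ^ (r / 2))
      else if i < τ i then X 1 + ((r - 1 : ℕ) : MvPolynomial (Fin 3) ℚ) * X 2 ^ r else 1 := by
  unfold localColors localWeight
  split_ifs with h1 h2
  · obtain ⟨s, rfl⟩ := heven.two_dvd
    have hs : 0 < 2 * s := Nat.pos_of_neZero _
    have hval : ((s : ℕ) : ZMod (2 * s)).val = s := ZMod.val_natCast_of_lt (by omega)
    have hne : (0 : ZMod (2 * s)) ≠ (s : ZMod (2 * s)) := by
      intro h0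
      rw [← h0, ZMod.val_zero] at hval
      omega
    rw [filter_add_self_eq_zero, Finset.sum_pair hne, hval, ZMod.val_zero,
      Nat.mul_div_cancel_left _ two_pos]
    ring
  · rw [Finset.sum_ite, Finset.filter_eq' univ, if_pos (Finset.mem_univ _), Finset.sum_singleton,
      Finset.sum_const, Finset.filter_ne' univ, Finset.card_erase_of_mem (Finset.mem_univ _),
      Finset.card_univ, ZMod.card, nsmul_eq_mul]
  · simp

lemma fpolyQ_eq_sum_perm {r p n : ℕ} [NeZero r] (heven : Even r) (hpr : p ∣ r / 2) :
    fpolyQ r p n = ∑ τ : Equiv.Perm (Fin n) with τ ^ 2 = 1,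
      (X 0 * (1 + X 2 ^ (r / 2))) ^ (n - 2 * lowerCard τ) *
        (X 1 + ((r - 1 : ℕ) : MvPolynomial (Fin 3) ℚ) * X 2 ^ r) ^ lowerCard τ := by
  rw [fpolyQ, Fintype.sum_prod_type_right, Finset.sum_filter]
  refine Finset.sum_congr rfl fun τ _ => ?_
  split_ifs with h
  · have hfix : #{i | τ i = i} = n - 2 * lowerCard τ := by
      have := card_fixed_add_two_mul_lowerCard h
      omega
    calc _ = ∑ z : Fin n → ZMod r with ∀ i, z i + z (τ i) = 0, ∏ i, localWeight τ i (z i) := by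
          rw [Finset.sum_filter]
          refine Finset.sum_congr rfl fun z _ => ?_
          by_cases hz : ∀ i, z i + z (τ i) = 0
          · have hinv := (isCPInvolution_iff z τ).2 ⟨h, hz⟩
            rw [if_pos ⟨hinv, dvd_csum_of_isCPInvolution heven hpr hinv⟩, if_pos hz,
              weight_eq_prod_localWeight h hz]
          · rw [if_neg hz, if_neg fun hc => hz ((isCPInvolution_iff z τ).1 hc.1).2]
      _ = _ := by
          rw [sum_prod_localWeight h, Finset.prod_congr rfl fun i _ => sum_localWeight heven τ i,
            prod_eq_prod_fixed_mul_prod_lt h, ← hfix, lowerCard, ← Finset.prod_const,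
            ← Finset.prod_const]
          congr 1
          · exact Finset.prod_congr rfl fun i hi => if_pos (Finset.mem_filter.1 hi).2
          · refine Finset.prod_congr rfl fun i hi => ?_
            have hi := (Finset.mem_filter.1 hi).2
            simp [apply_apply_of_sq_eq_one h, hi, hi.ne, hi.ne', hi.not_gt]
  · exact Finset.sum_eq_zero fun z _ => if_neg fun hc => h ((isCPInvolution_iff z τ).1 hc.1).1

lemma sq_eq_one_and_lowerCard_eq_iff {n k : ℕ} (τ : Equiv.Perm (Fin n)) :
    τ ^ 2 = 1 ∧ lowerCard τ = k ↔ τ.cycleType = Multiset.replicate k 2 := by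
  have key : τ ^ 2 = 1 → 2 * τ.cycleType.card = 2 * lowerCard τ := by
    intro h
    have h2 := Multiset.eq_replicate_card.2 (Equiv.Perm.pow_prime_eq_one_iff.1 h)
    have hsum := τ.sum_cycleType
    rw [h2, Multiset.sum_replicate, smul_eq_mul] at hsum
    have hfix := card_fixed_add_two_mul_lowerCard h
    have hcompl := Finset.card_filter_add_card_filter_not (s := univ) (fun i => τ i = i)
    have hsupp : #τ.support = #{i | ¬ τ i = i} := by
      congr 1
    rw [Finset.card_univ, Fintype.card_fin] at hcompl
    omega
  constructor
  · rintro ⟨h, rfl⟩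
    rw [Multiset.eq_replicate]
    exact ⟨Nat.eq_of_mul_eq_mul_left two_pos (key h), Equiv.Perm.pow_prime_eq_one_iff.1 h⟩
  · intro h
    have h1 : τ ^ 2 = 1 :=
      Equiv.Perm.pow_prime_eq_one_iff.2 fun c hc => Multiset.eq_of_mem_replicate (h ▸ hc)
    have h2 := key h1
    rw [h, Multiset.card_replicate] at h2
    exact ⟨h1, by omega⟩

lemma card_involutions_mul {n k : ℕ} (hk : 2 * k ≤ n) :
    #{τ : Equiv.Perm (Fin n) | τ ^ 2 = 1 ∧ lowerCard τ = k} *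
      ((n - 2 * k).factorial * 2 ^ k * k.factorial) = n.factorial := by
  have h := Equiv.Perm.card_of_cycleType_mul_eq (Fin n) (Multiset.replicate k 2)
  rw [if_pos ⟨by simpa [mul_comm] using hk, fun a ha => (Multiset.eq_of_mem_replicate ha).ge⟩] at h
  simp only [sq_eq_one_and_lowerCard_eq_iff]
  have hprod : ∏ m ∈ (Multiset.replicate k 2).toFinset,
      ((Multiset.replicate k 2).count m).factorial = k.factorial := by
    rcases Nat.eq_zero_or_pos k with rfl | hk0
    · simp
    · rw [Multiset.toFinset_replicate, if_neg hk0.ne']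
      simp
  rw [hprod] at h
  simpa [mul_comm k 2] using h

lemma coeff_eq_card_involutions {n j : ℕ} (hj : (n + 1) / 2 ≤ j) (hjn : j ≤ n) :
    (((n - j).factorial : ℚ) *
      (multinomialZ n [(n : ℤ) - j, (n : ℤ) - j, 2 * (j : ℤ) - n] : ℚ)) / 2 ^ (n - j) =
      #{τ : Equiv.Perm (Fin n) | τ ^ 2 = 1 ∧ lowerCard τ = n - j} := by
  obtain ⟨k, rfl⟩ := Nat.exists_eq_add_of_le hjn
  obtain ⟨m, rfl⟩ : ∃ m, j = k + m := Nat.exists_eq_add_of_le (by omega)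
  have hcard := card_involutions_mul (n := k + m + k) (k := k) (by omega)
  rw [show k + m + k - 2 * k = m by omega] at hcard
  have hsub : k + m + k - (k + m) = k := by omega
  have h1 : ((k + m + k : ℕ) : ℤ) - (k + m : ℕ) = (k : ℕ) := by push_cast; ring
  have h2 : 2 * ((k + m : ℕ) : ℤ) - (k + m + k : ℕ) = (m : ℕ) := by push_cast; ring
  have hdvd : k.factorial * (k.factorial * m.factorial) ∣ (k + m + k).factorial := by
    have := (mul_dvd_mul_left k.factorial (Nat.factorial_mul_factorial_dvd_factorial_add k m)).trans
      (Nat.factorial_mul_factorial_dvd_factorial_add k (k + m))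
    rwa [add_comm k (k + m)] at this
  have hmult : (multinomialZ (k + m + k : ℕ) [(k : ℤ), (k : ℤ), (m : ℤ)] : ℚ) =
      (k + m + k).factorial / (k.factorial * (k.factorial * m.factorial)) := by
    rw [multinomialZ, if_pos ⟨by simp, by simp; ring⟩]
    simp only [List.map_cons, List.map_nil, List.prod_cons, List.prod_nil, mul_one,
      Int.toNat_natCast]
    rw [Nat.cast_div hdvd (by positivity)]
    push_cast
    rfl
  rw [hsub, h1, h2, hmult, ← hcard]
  have := Nat.factorial_ne_zero k
  have := Nat.factorial_ne_zero m
  push_cast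
  field_simp

/-- For even `r ≥ 2` and `p ≥ 1` with `p ∣ r/2`, in `ℚ[u,v,w]`,
`f_{r,p,n} = Σ_{j=⌈n/2⌉}^{n} (n−j)!·C(n; n−j, n−j, 2j−n)·u^{2j−n}·(v + (r−1)wʳ)^{n−j}·(1 + w^{r/2})^{2j−n} / 2^{n−j}`. -/
theorem fpoly_explicit_even_dvd (r p n : ℕ) [NeZero r] (hr : 2 ≤ r) (heven : Even r)
    (hp : 1 ≤ p) (hpr : p ∣ r / 2) :
    fpolyQ r p n =
      ∑ j ∈ Finset.Icc ((n + 1) / 2) n,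
        MvPolynomial.C
            ((((n - j).factorial : ℚ) *
              (multinomialZ n [(n : ℤ) - j, (n : ℤ) - j, 2 * (j : ℤ) - n] : ℚ)) / 2 ^ (n - j)) *
          X 0 ^ (2 * j - n) *
          (X 1 + ((r - 1 : ℕ) : MvPolynomial (Fin 3) ℚ) * X 2 ^ r) ^ (n - j) *
          (1 + X 2 ^ (r / 2)) ^ (2 * j - n) := by

  have hmaps : ∀ τ ∈ ({τ | τ ^ 2 = 1} : Finset (Equiv.Perm (Fin n))),
      n - lowerCard τ ∈ Finset.Icc ((n + 1) / 2) n := by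
    intro τ hτ
    have := card_fixed_add_two_mul_lowerCard (Finset.mem_filter.1 hτ).2
    rw [Finset.mem_Icc]
    omega
  rw [fpolyQ_eq_sum_perm heven hpr, ← Finset.sum_fiberwise_of_maps_to hmaps]
  refine Finset.sum_congr rfl fun j hj => ?_
  obtain ⟨hj, hjn⟩ := Finset.mem_Icc.1 hj
  have hset : ({τ ∈ ({τ | τ ^ 2 = 1} : Finset (Equiv.Perm (Fin n))) | n - lowerCard τ = j}) =
      ({τ | τ ^ 2 = 1 ∧ lowerCard τ = n - j} : Finset (Equiv.Perm (Fin n))) := by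
    rw [Finset.filter_filter]
    refine Finset.filter_congr fun τ _ => and_congr_right fun h => ?_
    have := card_fixed_add_two_mul_lowerCard h
    omega
  rw [hset, coeff_eq_card_involutions hj hjn]
  have hterm : ∀ τ ∈ ({τ | τ ^ 2 = 1 ∧ lowerCard τ = n - j} : Finset (Equiv.Perm (Fin n))),
      (X 0 * (1 + X 2 ^ (r / 2))) ^ (n - 2 * lowerCard τ) *
        (X 1 + ((r - 1 : ℕ) : MvPolynomial (Fin 3) ℚ) * X 2 ^ r) ^ lowerCard τ =
      (X 0 * (1 + X 2 ^ (r / 2))) ^ (2 * j - n) *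
        (X 1 + ((r - 1 : ℕ) : MvPolynomial (Fin 3) ℚ) * X 2 ^ r) ^ (n - j) := by
    intro τ hτ
    rw [(Finset.mem_filter.1 hτ).2.2, show n - 2 * (n - j) = 2 * j - n by omega]
  rw [Finset.sum_congr rfl hterm, Finset.sum_const, nsmul_eq_mul, mul_pow, map_natCast]
  ring
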